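/- arXiv:2412.16067 — 2 statements merged into one kernel-verified Lean document; each statement's English description precedes it below -/
import Mathlib

section
/- Let α ∈ (0,1), γ, θ, ν > 0, ρ ∈ (−1,1), ξ ∈ ℂ, T > 0, and let h : [0,T] → ℂ be continuous. Suppose the function u(t) := (I^{1−α}h)(t) = (1/Γ(1−α)) ∫₀ᵗ (t−s)^{−α} h(s) ds satisfies u(0) = 0, u is continuous on [0,T], and u is differentiable at every t ∈ (0,T) with u′(t) = F(ξ, h(t)). Then h satisfies the Volterra equation h(t) = (1/Γ(α)) ∫₀ᵗ (t−s)^{α−1} F(ξ, h(s)) ds for all t ∈ [0,T]. -/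
open MeasureTheory Real

/-- The right-hand side of the rough Heston fractional Riccati equation. -/
noncomputable def riccatiF (γ ν ρ : ℝ) (ξ h : ℂ) : ℂ :=
  -(1 / 2 : ℂ) * (ξ ^ 2 + Complex.I * ξ) + (γ : ℂ) * (Complex.I * ξ * ρ * ν - 1) * h +
    ((γ : ℂ) * ν) ^ 2 / 2 * h ^ 2

/-- The Riemann–Liouville fractional integral `(I^β u)(t) = (1/Γ(β)) ∫₀ᵗ (t-s)^{β-1} u(s) ds`. -/
noncomputable def fracInt (β : ℝ) (u : ℝ → ℂ) (t : ℝ) : ℂ :=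
  ((1 / Real.Gamma β : ℝ) : ℂ) * ∫ s in (0 : ℝ)..t, (((t - s) ^ (β - 1) : ℝ) : ℂ) * u s

theorem intervalIntegrable_sub_rpow {β : ℝ} (hβ : 0 < β) (a b t : ℝ) :
    IntervalIntegrable (fun s => (t - s) ^ (β - 1)) volume a b := by
  have h := (intervalIntegral.intervalIntegrable_rpow' (a := t - a) (b := t - b)
    (show -1 < β - 1 by linarith)).comp_sub_left t
  simpa using h

theorem intervalIntegrable_fracInt_integrand {β T t : ℝ} {g : ℝ → ℂ} (hβ : 0 < β)
    (hg : ContinuousOn g (Set.Icc 0 T)) (ht : t ∈ Set.Icc 0 T) :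
    IntervalIntegrable (fun s => (((t - s) ^ (β - 1) : ℝ) : ℂ) * g s) volume 0 t := by
  refine IntervalIntegrable.mul_continuousOn ?_ ?_
  · have h := intervalIntegrable_sub_rpow hβ 0 t t
    exact ⟨h.1.ofReal, h.2.ofReal⟩
  · rw [Set.uIcc_of_le ht.1]
    exact hg.mono (Set.Icc_subset_Icc_right ht.2)

theorem fracInt_sub {β T t : ℝ} {g w : ℝ → ℂ} (hβ : 0 < β) (hg : ContinuousOn g (Set.Icc 0 T))
    (hw : ContinuousOn w (Set.Icc 0 T)) (ht : t ∈ Set.Icc 0 T) :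
    fracInt β (g - w) t = fracInt β g t - fracInt β w t := by
  simp only [fracInt, Pi.sub_apply, mul_sub]
  rw [intervalIntegral.integral_sub (intervalIntegrable_fracInt_integrand hβ hg ht)
    (intervalIntegrable_fracInt_integrand hβ hw ht), mul_sub]

theorem fracInt_congr {β t : ℝ} {g w : ℝ → ℂ} (ht : 0 ≤ t) (hgw : Set.EqOn g w (Set.Icc 0 t)) :
    fracInt β g t = fracInt β w t := by
  unfold fracInt
  congr 1
  refine intervalIntegral.integral_congr fun s hs => ?_
  rw [Set.uIcc_of_le ht] at hs
  simp only [hgw hs]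

theorem fracInt_one (g : ℝ → ℂ) (t : ℝ) : fracInt 1 g t = ∫ s in (0 : ℝ)..t, g s := by
  simp [fracInt]

theorem fracInt_eq_rpow_mul_integral {β t : ℝ} (hβ : 0 < β) (ht : 0 ≤ t) (g : ℝ → ℂ) :
    fracInt β g t = ((1 / Real.Gamma β : ℝ) : ℂ) * (((t ^ β : ℝ) : ℂ) *
      ∫ x in (0 : ℝ)..1, (((1 - x) ^ (β - 1) : ℝ) : ℂ) * g (t * x)) := by
  unfold fracInt
  congr 1
  rcases ht.eq_or_lt with rfl | ht
  · simp [Real.zero_rpow hβ.ne']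
  have h := intervalIntegral.smul_integral_comp_mul_left (a := 0) (b := 1)
    (fun s => (((t - s) ^ (β - 1) : ℝ) : ℂ) * g s) t
  rw [mul_zero, mul_one] at h
  rw [← h, ← intervalIntegral.integral_smul, ← intervalIntegral.integral_const_mul]
  refine intervalIntegral.integral_congr fun x hx => ?_
  rw [Set.uIcc_of_le zero_le_one] at hx
  have h1 : t * (t - t * x) ^ (β - 1) = t ^ β * (1 - x) ^ (β - 1) := by
    rw [show t - t * x = t * (1 - x) by ring, Real.mul_rpow ht.le (by linarith [hx.2]),
      ← mul_assoc, Real.rpow_sub_one ht.ne', mul_div_cancel₀ _ ht.ne']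
  simp only [Complex.real_smul, ← mul_assoc, ← Complex.ofReal_mul, h1]

theorem continuousOn_fracInt {β T : ℝ} {g : ℝ → ℂ} (hβ : 0 < β)
    (hg : ContinuousOn g (Set.Icc 0 T)) : ContinuousOn (fracInt β g) (Set.Icc 0 T) := by
  obtain ⟨C, hC⟩ := isCompact_Icc.exists_bound_of_continuousOn hg
  have hmaps : ∀ t ∈ Set.Icc 0 T, ∀ x ∈ Set.Icc (0 : ℝ) 1, t * x ∈ Set.Icc 0 T := fun t ht x hx =>
    ⟨mul_nonneg ht.1 hx.1, (mul_le_of_le_one_right ht.1 hx.2).trans ht.2⟩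
  refine ContinuousOn.congr ?_ fun t ht => fracInt_eq_rpow_mul_integral hβ ht.1 g
  refine continuousOn_const.mul (ContinuousOn.mul ?_ ?_)
  · exact (Complex.continuous_ofReal.comp (Real.continuous_rpow_const hβ.le)).continuousOn
  intro t₀ ht₀
  refine intervalIntegral.continuousWithinAt_of_dominated_interval
    (bound := fun x => (1 - x) ^ (β - 1) * C) ?_ ?_ ?_ ?_
  · filter_upwards [self_mem_nhdsWithin] with t ht
    rw [Set.uIoc_of_le zero_le_one]
    refine (Measurable.aestronglyMeasurable (by fun_prop)).mul ?_
    refine ContinuousOn.aestronglyMeasurable ?_ measurableSet_Ioc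
    exact hg.comp (by fun_prop) fun x hx => hmaps t ht x (Set.Ioc_subset_Icc_self hx)
  · filter_upwards [self_mem_nhdsWithin] with t ht
    refine Filter.Eventually.of_forall fun x hx => ?_
    rw [Set.uIoc_of_le zero_le_one] at hx
    have h1 : 0 ≤ (1 - x) ^ (β - 1) := Real.rpow_nonneg (by linarith [hx.2]) _
    rw [norm_mul, Complex.norm_real, Real.norm_of_nonneg h1]
    exact mul_le_mul_of_nonneg_left (hC _ (hmaps t ht x (Set.Ioc_subset_Icc_self hx))) h1
  · exact (intervalIntegrable_sub_rpow hβ 0 1 1).mul_const C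
  · refine Filter.Eventually.of_forall fun x hx => ?_
    rw [Set.uIoc_of_le zero_le_one] at hx
    refine continuousWithinAt_const.mul ?_
    refine ContinuousWithinAt.comp (t := Set.Icc 0 T)
      (hg _ (hmaps t₀ ht₀ x (Set.Ioc_subset_Icc_self hx))) (by fun_prop) ?_
    exact fun t ht => hmaps t ht x (Set.Ioc_subset_Icc_self hx)

theorem integral_sub_rpow_mul_sub_rpow {a b r t : ℝ} (ha : 0 < a) (hb : 0 < b) (hrt : r < t) :
    ∫ s in r..t, (t - s) ^ (a - 1) * (s - r) ^ (b - 1) =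
      (t - r) ^ (a + b - 1) * (Real.Gamma a * Real.Gamma b / Real.Gamma (a + b)) := by
  have hpos : 0 < t - r := sub_pos.2 hrt
  have h1 := intervalIntegral.integral_comp_sub_right (a := r) (b := t)
    (fun x => (t - r - x) ^ (a - 1) * x ^ (b - 1)) r
  simp only [sub_sub_sub_cancel_right, sub_self] at h1
  rw [h1]
  have h2 := Complex.betaIntegral_scaled b a hpos
  rw [Complex.betaIntegral_eq_Gamma_mul_div _ _ (by simpa) (by simpa)] at h2
  apply Complex.ofReal_injective
  rw [← intervalIntegral.integral_ofReal]
  convert! h2 using 1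
  · refine intervalIntegral.integral_congr fun x hx => ?_
    rw [Set.uIcc_of_le hpos.le] at hx
    have hx2 : 0 ≤ t - r - x := by linarith [hx.2]
    simp only [Complex.ofReal_mul, Complex.ofReal_cpow hx.1, Complex.ofReal_cpow hx2]
    push_cast
    ring
  · rw [Complex.ofReal_mul, Complex.ofReal_cpow hpos.le]
    simp only [← Complex.ofReal_add, Complex.Gamma_ofReal]
    push_cast
    rw [add_comm (a : ℂ) b, mul_comm (Real.Gamma a : ℂ), add_comm a b]

/-- The kernel of the iterated fractional integral, at `p = (s, r)` with `r < s`. -/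
noncomputable def iteratedFracKernel (a b t : ℝ) : ℝ × ℝ → ℝ :=
  {p : ℝ × ℝ | p.2 < p.1}.indicator fun p => (t - p.1) ^ (a - 1) * (p.1 - p.2) ^ (b - 1)

theorem iteratedFracKernel_left (a b t s : ℝ) :
    (fun r => iteratedFracKernel a b t (s, r)) =
      (Set.Iio s).indicator fun r => (t - s) ^ (a - 1) * (s - r) ^ (b - 1) := by
  ext r
  simp [iteratedFracKernel, Set.indicator_apply]

theorem iteratedFracKernel_right (a b t r : ℝ) :
    (fun s => iteratedFracKernel a b t (s, r)) =
      (Set.Ioi r).indicator fun s => (t - s) ^ (a - 1) * (s - r) ^ (b - 1) := by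
  ext s
  simp [iteratedFracKernel, Set.indicator_apply]

theorem setIntegral_indicator_Iio {E : Type*} [NormedAddCommGroup E] [NormedSpace ℝ E]
    (f : ℝ → E) {s t : ℝ} (hs : s ∈ Set.Ioc 0 t) :
    ∫ r in Set.Ioc 0 t, (Set.Iio s).indicator f r = ∫ r in (0 : ℝ)..s, f r := by
  have hset : Set.Ioc 0 t ∩ Set.Iio s = Set.Ioo 0 s := by
    ext r
    simp only [Set.mem_inter_iff, Set.mem_Ioc, Set.mem_Iio, Set.mem_Ioo]
    exact ⟨fun h => ⟨h.1.1, h.2⟩, fun h => ⟨⟨h.1, h.2.le.trans hs.2⟩, h.2⟩⟩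
  rw [setIntegral_indicator measurableSet_Iio, hset, ← integral_Ioc_eq_integral_Ioo,
    intervalIntegral.integral_of_le hs.1.le]

theorem setIntegral_indicator_Ioi {E : Type*} [NormedAddCommGroup E] [NormedSpace ℝ E]
    (f : ℝ → E) {r t : ℝ} (hr : r ∈ Set.Ioc 0 t) :
    ∫ s in Set.Ioc 0 t, (Set.Ioi r).indicator f s = ∫ s in r..t, f s := by
  rw [setIntegral_indicator measurableSet_Ioi, Set.Ioc_inter_Ioi, max_eq_right hr.1.le,
    intervalIntegral.integral_of_le hr.2]

theorem integrable_iteratedFracKernel {a b t : ℝ} (ha : 0 < a) (hb : 0 < b) (ht : 0 ≤ t) :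
    Integrable (iteratedFracKernel a b t)
      ((volume.restrict (Set.Ioc 0 t)).prod (volume.restrict (Set.Ioc 0 t))) := by
  have hmeas : Measurable (iteratedFracKernel a b t) :=
    Measurable.indicator (by fun_prop) (measurableSet_lt measurable_snd measurable_fst)
  rw [integrable_prod_iff hmeas.aestronglyMeasurable]
  constructor
  · filter_upwards [ae_restrict_mem measurableSet_Ioc] with s hs
    rw [iteratedFracKernel_left, integrable_indicator_iff measurableSet_Iio, IntegrableOn,
      Measure.restrict_restrict measurableSet_Iio]
    have h := (intervalIntegrable_sub_rpow hb 0 s s).const_mul ((t - s) ^ (a - 1))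
    rw [intervalIntegrable_iff_integrableOn_Ioc_of_le hs.1.le] at h
    exact h.mono_set fun r hr => ⟨hr.2.1, le_of_lt hr.1⟩
  · have h : IntervalIntegrable (fun s => (t - s) ^ (a - 1) * (s ^ b / b)) volume 0 t :=
      (intervalIntegrable_sub_rpow ha 0 t t).mul_continuousOn
        ((Real.continuous_rpow_const hb.le).div_const b).continuousOn
    rw [intervalIntegrable_iff_integrableOn_Ioc_of_le ht] at h
    refine h.congr ?_
    filter_upwards [ae_restrict_mem measurableSet_Ioc] with s hs
    have hK : ∀ r, ‖iteratedFracKernel a b t (s, r)‖ = iteratedFracKernel a b t (s, r) := by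
      intro r
      refine Real.norm_of_nonneg (Set.indicator_apply_nonneg fun hr => ?_)
      exact mul_nonneg (Real.rpow_nonneg (sub_nonneg.2 hs.2) _)
        (Real.rpow_nonneg (sub_nonneg.2 (le_of_lt hr)) _)
    simp only [hK]
    rw [iteratedFracKernel_left, setIntegral_indicator_Iio _ hs,
      intervalIntegral.integral_const_mul,
      intervalIntegral.integral_comp_sub_left (fun x => x ^ (b - 1)), sub_self, sub_zero,
      integral_rpow (Or.inl (by linarith)), sub_add_cancel, Real.zero_rpow hb.ne', sub_zero]

/-- The semigroup property of the Riemann–Liouville fractional integral. -/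
theorem fracInt_fracInt {a b t : ℝ} {g : ℝ → ℂ} (ha : 0 < a) (hb : 0 < b) (ht : 0 ≤ t)
    (hg : ContinuousOn g (Set.Icc 0 t)) :
    fracInt a (fracInt b g) t = fracInt (a + b) g t := by
  obtain ⟨C, hC⟩ := isCompact_Icc.exists_bound_of_continuousOn hg
  have hint : Integrable
      (Function.uncurry fun s r => (iteratedFracKernel a b t (s, r) : ℂ) * g r)
      ((volume.restrict (Set.Ioc 0 t)).prod (volume.restrict (Set.Ioc 0 t))) := by
    refine (integrable_iteratedFracKernel ha hb ht).ofReal.mul_bdd (c := C) ?_ ?_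
    · have := (hg.mono Set.Ioc_subset_Icc_self).aestronglyMeasurable (μ := volume) measurableSet_Ioc
      exact this.comp_snd
    · rw [Measure.prod_restrict]
      filter_upwards [ae_restrict_mem (measurableSet_Ioc.prod measurableSet_Ioc)] with p hp
      exact hC _ (Set.Ioc_subset_Icc_self hp.2)
  have hswap := integral_integral_swap hint
  have hleft : ∫ s in Set.Ioc 0 t, ∫ r in Set.Ioc 0 t,
      (iteratedFracKernel a b t (s, r) : ℂ) * g r =
      ∫ s in (0 : ℝ)..t, (((t - s) ^ (a - 1) : ℝ) : ℂ) *
        ∫ r in (0 : ℝ)..s, (((s - r) ^ (b - 1) : ℝ) : ℂ) * g r := by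
    rw [intervalIntegral.integral_of_le ht]
    refine setIntegral_congr_fun measurableSet_Ioc fun s hs => ?_
    rw [← intervalIntegral.integral_const_mul, ← setIntegral_indicator_Iio _ hs]
    congr 1
    ext r
    rw [congrFun (iteratedFracKernel_left a b t s) r]
    by_cases hr : r ∈ Set.Iio s <;> simp [hr, mul_assoc]
  have hright : ∫ r in Set.Ioc 0 t, ∫ s in Set.Ioc 0 t,
      (iteratedFracKernel a b t (s, r) : ℂ) * g r =
      ((Real.Gamma a * Real.Gamma b / Real.Gamma (a + b) : ℝ) : ℂ) *
        ∫ r in (0 : ℝ)..t, (((t - r) ^ (a + b - 1) : ℝ) : ℂ) * g r := by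
    rw [intervalIntegral.integral_of_le ht, ← integral_const_mul, integral_Ioc_eq_integral_Ioo,
      integral_Ioc_eq_integral_Ioo]
    refine setIntegral_congr_fun measurableSet_Ioo fun r hr => ?_
    rw [integral_mul_const, integral_complex_ofReal, iteratedFracKernel_right,
      setIntegral_indicator_Ioi _ (Set.Ioo_subset_Ioc_self hr),
      integral_sub_rpow_mul_sub_rpow ha hb hr.2]
    push_cast
    ring
  rw [hleft, hright] at hswap
  have hΓa := Complex.ofReal_ne_zero.2 (Real.Gamma_pos_of_pos ha).ne'
  have hΓb := Complex.ofReal_ne_zero.2 (Real.Gamma_pos_of_pos hb).ne'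
  simp only [fracInt, mul_left_comm _ ((1 / Real.Gamma b : ℝ) : ℂ)]
  rw [intervalIntegral.integral_const_mul, hswap]
  push_cast
  field_simp

theorem eqOn_zero_of_integral_eq_zero {T : ℝ} {g : ℝ → ℂ} (hT : 0 < T)
    (hg : ContinuousOn g (Set.Icc 0 T))
    (hint : ∀ t ∈ Set.Icc 0 T, ∫ s in (0 : ℝ)..t, g s = 0) :
    Set.EqOn g 0 (Set.Icc 0 T) := by
  have hIoo : Set.EqOn g 0 (Set.Ioo 0 T) := by
    intro t ht
    have hd := intervalIntegral.integral_hasDerivAt_right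
      (ContinuousOn.intervalIntegrable_of_Icc ht.1.le (hg.mono (Set.Icc_subset_Icc_right ht.2.le)))
      ((hg.mono Set.Ioo_subset_Icc_self).stronglyMeasurableAtFilter isOpen_Ioo t ht)
      (hg.continuousAt (Icc_mem_nhds ht.1 ht.2))
    refine hd.unique ((hasDerivAt_const t (0 : ℂ)).congr_of_eventuallyEq ?_)
    filter_upwards [Icc_mem_nhds ht.1 ht.2] with x hx using hint x hx
  refine hIoo.of_subset_closure hg continuousOn_const Set.Ioo_subset_Icc_self ?_
  rw [closure_Ioo hT.ne]

theorem continuous_riccatiF (γ ν ρ : ℝ) (ξ : ℂ) : Continuous (riccatiF γ ν ρ ξ) := by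
  unfold riccatiF
  fun_prop

theorem stmt5 (α γ θ ν ρ : ℝ) (hα : α ∈ Set.Ioo (0 : ℝ) 1) (hγ : 0 < γ) (hθ : 0 < θ)
    (hν : 0 < ν) (hρ : ρ ∈ Set.Ioo (-1 : ℝ) 1) (ξ : ℂ) (T : ℝ) (hT : 0 < T)
    (h : ℝ → ℂ) (hcont : ContinuousOn h (Set.Icc 0 T))
    (h0 : fracInt (1 - α) h 0 = 0)
    (hucont : ContinuousOn (fracInt (1 - α) h) (Set.Icc 0 T))
    (hderiv : ∀ t ∈ Set.Ioo (0 : ℝ) T,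
      HasDerivAt (fracInt (1 - α) h) (riccatiF γ ν ρ ξ (h t)) t) :
    ∀ t ∈ Set.Icc (0 : ℝ) T,
      h t = ((1 / Real.Gamma α : ℝ) : ℂ) *
        ∫ s in (0 : ℝ)..t, (((t - s) ^ (α - 1) : ℝ) : ℂ) * riccatiF γ ν ρ ξ (h s) := by
  have hα' : 0 < 1 - α := sub_pos.2 hα.2
  set f : ℝ → ℂ := fun s => riccatiF γ ν ρ ξ (h s)
  have hf : ContinuousOn f (Set.Icc 0 T) := (continuous_riccatiF γ ν ρ ξ).comp_continuousOn hcont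
  have hw : ContinuousOn (fracInt α f) (Set.Icc 0 T) := continuousOn_fracInt hα.1 hf
  have hsub : ∀ t ∈ Set.Icc 0 T, Set.Icc 0 t ⊆ Set.Icc 0 T := fun t ht =>
    Set.Icc_subset_Icc_right ht.2
  have hprim : ∀ t ∈ Set.Icc 0 T, fracInt (1 - α) h t = ∫ s in (0 : ℝ)..t, f s := by
    intro t ht
    rw [intervalIntegral.integral_eq_sub_of_hasDerivAt_of_le ht.1 (hucont.mono (hsub t ht))
      (fun x hx => hderiv x ⟨hx.1, hx.2.trans_le ht.2⟩)
      (ContinuousOn.intervalIntegrable_of_Icc ht.1 (hf.mono (hsub t ht))), h0, sub_zero]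
  have hdiff : ∀ t ∈ Set.Icc 0 T, fracInt (1 - α) (h - fracInt α f) t = 0 := by
    intro t ht
    rw [fracInt_sub hα' hcont hw ht, fracInt_fracInt hα' hα.1 ht.1 (hf.mono (hsub t ht)),
      sub_add_cancel, fracInt_one, hprim t ht, sub_self]
  have hzero : Set.EqOn (h - fracInt α f) 0 (Set.Icc 0 T) := by
    refine eqOn_zero_of_integral_eq_zero hT (hcont.sub hw) fun t ht => ?_
    have hsemi := fracInt_fracInt hα.1 hα' ht.1 ((hcont.sub hw).mono (hsub t ht))
    rw [add_sub_cancel, fracInt_one] at hsemi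
    refine hsemi.symm.trans ?_
    rw [fracInt_congr (w := 0) ht.1 fun s hs => hdiff s (hsub t ht hs)]
    simp [fracInt]
  exact fun t ht => sub_eq_zero.1 (hzero ht)
end

section
/- Let X be a real-valued random variable on a probability space, let S₀, K > 0, and let ω₁ < −1 be such that E[e^{−ω₁ X}] < ∞. For ξ ∈ ℂ with Im ξ = ω₁ set Φ(ξ) = E[e^{iξX}]. Then E[(S₀e^X − K)₊] = −(K/π) · Re ∫₀^∞ e^{i(u+iω₁) ln(S₀/K)} Φ(u+iω₁) / ((u+iω₁)(u+iω₁+i)) du. -/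
open MeasureTheory Real

/-- The inverse Laplace integrand of `y ↦ (exp y - 1)₊` on the line `Re s = c`. -/
noncomputable def laplaceCallIntegrand (c y u : ℝ) : ℂ :=
  Complex.exp ((c + u * Complex.I) * y) / ((c + u * Complex.I) * (c + u * Complex.I - 1))

lemma hasMellin_max_inv_sub_one {s : ℂ} (hs : 1 < s.re) :
    HasMellin (fun x : ℝ => ((max (x⁻¹ - 1) 0 : ℝ) : ℂ)) s (1 / (s * (s - 1))) := by
  have h1 := hasMellin_cpow_Ioc (-1) (s := s) (by simp; linarith)
  have h0 := hasMellin_one_Ioc (s := s) (by linarith)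
  have h := hasMellin_sub h1.1 h0.1
  have heq : ∀ x ∈ Set.Ioi (0 : ℝ),
      (Set.Ioc (0 : ℝ) 1).indicator (fun t : ℝ => (t : ℂ) ^ (-1 : ℂ)) x -
        (Set.Ioc (0 : ℝ) 1).indicator (fun _ => (1 : ℂ)) x = ((max (x⁻¹ - 1) 0 : ℝ) : ℂ) := by
    intro x hx
    have hx : 0 < x := hx
    by_cases hx1 : x ≤ 1
    · have : 0 ≤ x⁻¹ - 1 := by linarith [(one_le_inv₀ hx).2 hx1]
      simp [hx, hx1, max_eq_left this, Complex.cpow_neg_one]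
    · have : x⁻¹ - 1 ≤ 0 := by linarith [inv_le_one_of_one_le₀ (not_le.1 hx1).le]
      simp [hx1, max_eq_right this]
  have hs0 : s ≠ 0 := fun h => by simp [h] at hs; linarith
  have hs1 : s - 1 ≠ 0 := fun h => by
    rw [sub_eq_zero.1 h] at hs; simp at hs
  refine ⟨h.1.congr_fun (fun x hx => ?_) measurableSet_Ioi, ?_⟩
  · simp only [heq x hx]
  · have hval := h.2
    rw [h1.2, h0.2] at hval
    calc _ = _ := (setIntegral_congr_fun measurableSet_Ioi
            fun x hx => by simp only [heq x hx]).symm.trans hval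
      _ = _ := by
        rw [← sub_eq_add_neg]
        field_simp
        ring

lemma norm_laplaceCallIntegrand (c y u : ℝ) :
    ‖laplaceCallIntegrand c y u‖ = rexp (c * y) * ‖laplaceCallIntegrand c 0 u‖ := by
  simp [laplaceCallIntegrand, Complex.norm_exp, div_eq_mul_inv]

lemma measurable_uncurry_laplaceCallIntegrand (c : ℝ) :
    Measurable fun p : ℝ × ℝ => laplaceCallIntegrand c p.1 p.2 := by
  unfold laplaceCallIntegrand
  fun_prop

lemma integrable_laplaceCallIntegrand_zero {c : ℝ} (hc : 1 < c) :
    Integrable (laplaceCallIntegrand c 0) := by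
  set m := min ((c - 1) ^ 2) 1 with hm
  have hm0 : 0 < m := lt_min (by have : 0 < c - 1 := by linarith
                                 positivity) one_pos
  refine (integrable_inv_one_add_sq.const_mul m⁻¹).mono'
    ((measurable_uncurry_laplaceCallIntegrand c).comp
      measurable_prodMk_left).aestronglyMeasurable (Filter.Eventually.of_forall fun u => ?_)
  have hn : ∀ a : ℝ, ‖(a : ℂ) + u * Complex.I‖ = √(a ^ 2 + u ^ 2) := fun a =>
    Complex.norm_add_mul_I a u
  have h1 : (c : ℂ) + u * Complex.I - 1 = ((c - 1 : ℝ) : ℂ) + u * Complex.I := by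
    push_cast; ring
  have hle : m * (1 + u ^ 2) ≤ (c - 1) ^ 2 + u ^ 2 := by
    nlinarith [min_le_left ((c - 1) ^ 2) 1, min_le_right ((c - 1) ^ 2) 1, sq_nonneg u]
  have hmono : √((c - 1) ^ 2 + u ^ 2) ≤ √(c ^ 2 + u ^ 2) := Real.sqrt_le_sqrt (by nlinarith)
  have hden : m * (1 + u ^ 2) ≤ √(c ^ 2 + u ^ 2) * √((c - 1) ^ 2 + u ^ 2) :=
    calc _ ≤ (c - 1) ^ 2 + u ^ 2 := hle
      _ = √((c - 1) ^ 2 + u ^ 2) * √((c - 1) ^ 2 + u ^ 2) :=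
        (Real.mul_self_sqrt (by positivity)).symm
      _ ≤ _ := by gcongr
  rw [laplaceCallIntegrand, norm_div, norm_mul, h1, hn, hn, ← mul_inv]
  simpa using inv_anti₀ (by positivity) hden

lemma integrable_laplaceCallIntegrand {c : ℝ} (hc : 1 < c) (y : ℝ) :
    Integrable (laplaceCallIntegrand c y) :=
  ((integrable_laplaceCallIntegrand_zero hc).norm.const_mul (rexp (c * y))).mono'
    ((measurable_uncurry_laplaceCallIntegrand c).comp
      measurable_prodMk_left).aestronglyMeasurable
    (Filter.Eventually.of_forall fun u => (norm_laplaceCallIntegrand c y u).le)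

lemma integral_laplaceCallIntegrand {c : ℝ} (hc : 1 < c) (y : ℝ) :
    ∫ u, laplaceCallIntegrand c y u = ((2 * π * max (rexp y - 1) 0 : ℝ) : ℂ) := by
  have hM : ∀ u : ℝ, mellin (fun x : ℝ => ((max (x⁻¹ - 1) 0 : ℝ) : ℂ)) (c + u * Complex.I) =
      1 / ((c + u * Complex.I) * (c + u * Complex.I - 1)) := fun u =>
    (hasMellin_max_inv_sub_one (by simpa using hc)).2
  have h := mellinInv_mellin_eq c (fun x : ℝ => ((max (x⁻¹ - 1) 0 : ℝ) : ℂ)) (exp_pos (-y))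
    (hasMellin_max_inv_sub_one (by simpa using hc)).1
    (by
      rw [Complex.VerticalIntegrable]
      simp_rw [hM]
      refine (integrable_laplaceCallIntegrand_zero hc).congr
        (Filter.Eventually.of_forall fun u => ?_)
      simp [laplaceCallIntegrand])
    (by
      have := (exp_pos (-y)).ne'
      fun_prop (disch := assumption))
  have hint : ∀ u : ℝ, ((rexp (-y) : ℝ) : ℂ) ^ (-((c : ℂ) + u * Complex.I)) •
      (1 / (((c : ℂ) + u * Complex.I) * (c + u * Complex.I - 1))) =
        laplaceCallIntegrand c y u := fun u => by
    rw [Complex.cpow_def_of_ne_zero (by exact_mod_cast (exp_pos (-y)).ne'),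
      ← Complex.ofReal_log (exp_pos _).le, Real.log_exp, laplaceCallIntegrand, smul_eq_mul,
      mul_one_div]
    congr 2
    push_cast
    ring
  simp only [mellinInv, hM, hint, ← Real.exp_neg, neg_neg] at h
  rw [Complex.ofReal_mul, ← h, Complex.real_smul, ← mul_assoc, ← Complex.ofReal_mul,
    mul_one_div_cancel (by positivity), Complex.ofReal_one, one_mul]

lemma laplaceCallIntegrand_neg (c y u : ℝ) :
    laplaceCallIntegrand c y (-u) = starRingEnd ℂ (laplaceCallIntegrand c y u) := by
  simp [laplaceCallIntegrand, ← Complex.exp_conj]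

lemma re_setIntegral_laplaceCallIntegrand {c : ℝ} (hc : 1 < c) (y : ℝ) :
    (∫ u in Set.Ioi (0 : ℝ), laplaceCallIntegrand c y u).re = π * max (rexp y - 1) 0 := by
  have h := integral_add_compl (measurableSet_Ioi (a := (0 : ℝ)))
    (integrable_laplaceCallIntegrand hc y)
  have hneg := integral_comp_neg_Ioi (0 : ℝ) (laplaceCallIntegrand c y)
  simp only [laplaceCallIntegrand_neg, integral_conj, neg_zero] at hneg
  rw [Set.compl_Ioi, ← hneg, integral_laplaceCallIntegrand hc] at h
  have := congrArg Complex.re h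
  rw [Complex.add_re, Complex.conj_re, Complex.ofReal_re] at this
  linarith

lemma integrable_prod_laplaceCallIntegrand {Ω : Type*} [MeasurableSpace Ω] {μ : Measure Ω}
    [SFinite μ] {Y : Ω → ℝ} (hY : Measurable Y) {c : ℝ} (hc : 1 < c)
    (hint : Integrable (fun a => rexp (c * Y a)) μ) :
    Integrable (Function.uncurry fun a u => laplaceCallIntegrand c (Y a) u)
      (μ.prod (volume.restrict (Set.Ioi 0))) := by
  refine (hint.mul_prod (integrable_laplaceCallIntegrand_zero hc).norm.restrict).mono' ?_
    (Filter.Eventually.of_forall fun p => (norm_laplaceCallIntegrand c (Y p.1) p.2).le)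
  exact ((measurable_uncurry_laplaceCallIntegrand c).comp
    ((hY.comp measurable_fst).prodMk measurable_snd)).aestronglyMeasurable

lemma integral_max_exp_sub_one {Ω : Type*} [MeasurableSpace Ω] {μ : Measure Ω}
    [SFinite μ] {Y : Ω → ℝ} (hY : Measurable Y) {c : ℝ} (hc : 1 < c)
    (hint : Integrable (fun a => rexp (c * Y a)) μ) :
    (∫ u in Set.Ioi (0 : ℝ), ∫ a, laplaceCallIntegrand c (Y a) u ∂μ).re =
      π * ∫ a, max (rexp (Y a) - 1) 0 ∂μ := by
  have hp := integrable_prod_laplaceCallIntegrand hY hc hint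
  rw [← integral_integral_swap hp, ← integral_const_mul]
  refine (integral_re (𝕜 := ℂ) hp.integral_prod_left).symm.trans
    (integral_congr_ae (Filter.Eventually.of_forall fun a => ?_))
  exact re_setIntegral_laplaceCallIntegrand hc (Y a)

theorem stmt12 {Ω : Type*} [MeasurableSpace Ω] (μ : Measure Ω) [IsProbabilityMeasure μ]
    (X : Ω → ℝ) (hX : Measurable X) (S₀ K ω₁ : ℝ) (hS : 0 < S₀) (hK : 0 < K)
    (hω : ω₁ < -1)
    (hmom : Integrable (fun a => Real.exp (-ω₁ * X a)) μ) :
    (∫ a, max (S₀ * Real.exp (X a) - K) 0 ∂μ) =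
      -(K / Real.pi) *
        (∫ u in Set.Ioi (0 : ℝ),
          Complex.exp (Complex.I * (u + Complex.I * ω₁) * Real.log (S₀ / K)) *
            (∫ a, Complex.exp (Complex.I * (u + Complex.I * ω₁) * X a) ∂μ) /
            ((u + Complex.I * ω₁) * (u + Complex.I * ω₁ + Complex.I))).re := by
  set k := Real.log (S₀ / K) with hk
  have hc : 1 < -ω₁ := by linarith
  have hY : Measurable fun a => k + X a := hX.const_add k
  have hint : Integrable (fun a => rexp (-ω₁ * (k + X a))) μ := by
    simp_rw [mul_add, Real.exp_add]
    exact hmom.const_mul _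
  have hmain := integral_max_exp_sub_one hY hc hint
  have hpay : ∀ a, max (S₀ * rexp (X a) - K) 0 = K * max (rexp (k + X a) - 1) 0 := fun a => by
    rw [mul_max_of_nonneg _ _ hK.le, Real.exp_add, hk, Real.exp_log (by positivity)]
    field_simp
    simp
  have hker : ∀ u : ℝ,
      Complex.exp (Complex.I * (u + Complex.I * ω₁) * k) *
        (∫ a, Complex.exp (Complex.I * (u + Complex.I * ω₁) * X a) ∂μ) /
        ((u + Complex.I * ω₁) * (u + Complex.I * ω₁ + Complex.I)) =
      -∫ a, laplaceCallIntegrand (-ω₁) (k + X a) u ∂μ := fun u => by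
    have hs : Complex.I * (u + Complex.I * ω₁) = ((-ω₁ : ℝ) : ℂ) + u * Complex.I := by
      push_cast
      linear_combination (ω₁ : ℂ) * Complex.I_mul_I
    have hden : (u + Complex.I * ω₁) * (u + Complex.I * ω₁ + Complex.I) =
        -((((-ω₁ : ℝ) : ℂ) + u * Complex.I) * (((-ω₁ : ℝ) : ℂ) + u * Complex.I - 1)) := by
      rw [← hs]
      linear_combination ((u + Complex.I * ω₁) ^ 2 : ℂ) * Complex.I_mul_I
    rw [hden, hs, div_neg, ← integral_const_mul, ← integral_div]
    congr 2
    ext a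
    rw [laplaceCallIntegrand, ← Complex.exp_add]
    congr 2
    push_cast
    ring
  simp_rw [hpay, hker]
  rw [integral_const_mul, integral_neg, Complex.neg_re, hmain]
  field_simp
end
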